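/- arXiv:1111.7109 — 2 statements merged into one kernel-verified Lean document; each statement's English description precedes it below -/
import Mathlib

section
/- A permutation f of P preserves the ternary relation Cyc if and only if f is a rotation of P. -/
variable {P : Type} [PartialOrder P]

/-- `a` and `b` are incomparable elements of the partial order `P`. -/
def Perp (a b : P) : Prop := ¬ a ≤ b ∧ ¬ b ≤ a

/-- `f` is an order-automorphism of `P`. -/
def IsOrderAuto (f : Equiv.Perm P) : Prop := ∀ a b : P, f a ≤ f b ↔ a ≤ b

/-- `f` is an anti-automorphism of `P`. -/
def IsAntiAuto (f : Equiv.Perm P) : Prop := ∀ a b : P, f a ≤ f b ↔ b ≤ a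

/-- Every finite partial order embeds into `P` (universality). -/
def IsUniversal (P : Type) [PartialOrder P] : Prop :=
  ∀ (Q : Type) [PartialOrder Q] [Fintype Q], Nonempty (Q ↪o P)

/-- Every order-isomorphism between two finite subsets of `P` extends to an
order-automorphism of `P` (homogeneity). -/
def IsHomogeneous (P : Type) [PartialOrder P] : Prop :=
  ∀ (S T : Finset P) (e : (S : Set P) ≃o (T : Set P)),
    ∃ g : P ≃o P, ∀ x : (S : Set P), g ↑x = ↑(e x)

/-- A subgroup of `Sym(P)` is closed iff it contains every permutation that agrees
with one of its members on each finite subset of `P`. -/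
def IsClosedSubgroup (G : Subgroup (Equiv.Perm P)) : Prop :=
  ∀ f : Equiv.Perm P,
    (∀ S : Finset P, ∃ g ∈ G, ∀ x ∈ S, (g : Equiv.Perm P) x = f x) → f ∈ G

/-- `h` is an order-automorphism of `P` fixing each of the constants `c i`. -/
def FixingAuto (n : ℕ) (c : Fin n → P) (h : Equiv.Perm P) : Prop :=
  IsOrderAuto h ∧ ∀ i : Fin n, h (c i) = c i

/-- `X` is an orbit of `(P, c₁, …, cₙ)`, i.e. an orbit of the action on `P` of the
group of automorphisms of `P` fixing each `c i`. -/
def IsOrbit (n : ℕ) (c : Fin n → P) (X : Set P) : Prop :=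
  ∃ x : P, X = {y | ∃ h : Equiv.Perm P, FixingAuto n c h ∧ h x = y}

/-- `g` is canonical as a function from `(P, c₁, …, cₙ)` to `P`. -/
def Canonical (n : ℕ) (c : Fin n → P) (g : P → P) : Prop :=
  ∀ (m : ℕ) (a b : Fin m → P),
    (∃ h : Equiv.Perm P, FixingAuto n c h ∧ ∀ j : Fin m, h (a j) = b j) →
    ∃ h' : Equiv.Perm P, IsOrderAuto h' ∧ ∀ j : Fin m, h' (g (a j)) = g (b j)

/-- `g` is M-generated by the subgroup `G` of `Sym(P)`: on every finite subset of `P`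
it agrees with some member of `G`. -/
def MGen (G : Subgroup (Equiv.Perm P)) (g : P → P) : Prop :=
  ∀ S : Finset P, ∃ h ∈ G, ∀ x ∈ S, (h : Equiv.Perm P) x = g x

/-- `g` behaves like `id` on `X`. -/
def BehavesLikeId (g : P → P) (X : Set P) : Prop :=
  ∀ x ∈ X, ∀ x' ∈ X, (x < x' → g x < g x') ∧ (Perp x x' → Perp (g x) (g x'))

/-- `g` behaves like `↕` on `X`. -/
def BehavesLikeRev (g : P → P) (X : Set P) : Prop :=
  ∀ x ∈ X, ∀ x' ∈ X, (x < x' → g x' < g x) ∧ (Perp x x' → Perp (g x) (g x'))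

/-- `g` behaves like `id` between `X` and `Y`. -/
def BehavesLikeIdBetween (g : P → P) (X Y : Set P) : Prop :=
  ∀ x ∈ X, ∀ y ∈ Y,
    (x < y → g x < g y) ∧ (y < x → g y < g x) ∧ (Perp x y → Perp (g x) (g y))

/-- `X ≤ Y` for subsets: some element of `X` lies below some element of `Y`. -/
def SetLE (X Y : Set P) : Prop := ∃ x ∈ X, ∃ y ∈ Y, x ≤ y

/-- `X < Y` for subsets: every element of `X` lies strictly below every element of `Y`. -/
def SetLT (X Y : Set P) : Prop := ∀ x ∈ X, ∀ y ∈ Y, x < y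

/-- The relation `X ÷ Y`. -/
def SetDiv (X Y : Set P) : Prop :=
  (SetLE X Y ∧ ¬ SetLE Y X ∧ ¬ SetLT X Y) ∨ (SetLE Y X ∧ ¬ SetLE X Y ∧ ¬ SetLT Y X)

/-- `f` is a rotation of `P`. -/
def IsRotation (f : Equiv.Perm P) : Prop :=
  ∃ X Y Z : Set P,
    (∀ p : P, p ∈ X ∨ p ∈ Y ∨ p ∈ Z) ∧
    Disjoint X Y ∧ Disjoint X Z ∧ Disjoint Y Z ∧
    IsLowerSet X ∧ IsUpperSet Z ∧
    (∀ x ∈ X, ∀ z ∈ Z, x < z) ∧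
    BehavesLikeId (⇑f) X ∧ BehavesLikeId (⇑f) Y ∧ BehavesLikeId (⇑f) Z ∧
    (∀ x ∈ X, ∀ z ∈ Z, f z < f x) ∧
    (∀ x ∈ X, ∀ y ∈ Y, (f y < f x ↔ Perp x y) ∧ (Perp (f x) (f y) ↔ x < y)) ∧
    (∀ y ∈ Y, ∀ z ∈ Z, (f z < f y ↔ Perp y z) ∧ (Perp (f y) (f z) ↔ y < z))

/-- The ternary relation `Cyc`. -/
def Cyc (a b c : P) : Prop :=
  (a < b ∧ b < c) ∨ (b < c ∧ c < a) ∨ (c < a ∧ a < b) ∨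
  (a < b ∧ Perp c a ∧ Perp c b) ∨ (b < c ∧ Perp a b ∧ Perp a c) ∨
  (c < a ∧ Perp b a ∧ Perp b c)

/-- The ternary relation `Cyc'`, the dual of `Cyc`. -/
def Cyc' (a b c : P) : Prop := Cyc c b a

/-- The ternary relation `Pari`. -/
def Pari (a b c : P) : Prop :=
  (Perp a b ∧ Perp b c ∧ Perp a c) ∨
  (a < b ∧ a < c ∧ Perp b c) ∨ (b < a ∧ b < c ∧ Perp a c) ∨ (c < a ∧ c < b ∧ Perp a b) ∨
  (b < a ∧ c < a ∧ Perp b c) ∨ (a < b ∧ c < b ∧ Perp a c) ∨ (a < c ∧ b < c ∧ Perp a b)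

/-- `f` preserves the ternary relation `R`. -/
def Preserves3 (f : P → P) (R : P → P → P → Prop) : Prop :=
  ∀ a b c : P, R a b c ↔ R (f a) (f b) (f c)

/-- The order type of a pair, in `ZMod 3`: `1` for `a < b`, `-1` for `b < a`, `0` otherwise. -/
noncomputable def orderSign (a b : P) : ZMod 3 :=
  open Classical in if a < b then 1 else if b < a then -1 else 0

theorem orderSign_eq_one {a b : P} : orderSign a b = 1 ↔ a < b := by
  have h₀ : (0 : ZMod 3) ≠ 1 := by decide
  have h₁ : (-1 : ZMod 3) ≠ 1 := by decide
  unfold orderSign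
  split_ifs <;> simp [*]

theorem orderSign_eq_neg_one {a b : P} : orderSign a b = -1 ↔ b < a := by
  have h₀ : (0 : ZMod 3) ≠ -1 := by decide
  have h₁ : (1 : ZMod 3) ≠ -1 := by decide
  unfold orderSign
  split_ifs with h <;> simp [*, lt_asymm]

theorem orderSign_swap (a b : P) : orderSign b a = -orderSign a b := by
  unfold orderSign
  by_cases h₁ : a < b
  · simp [h₁, h₁.asymm]
  · by_cases h₂ : b < a <;> simp [h₁, h₂]

theorem orderSign_self (a : P) : orderSign a a = 0 := by simp [orderSign]

theorem zmod_three_cases : ∀ x : ZMod 3, x = 0 ∨ x = 1 ∨ x = -1 := by decide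

theorem orderSign_eq_zero_of_perp {a b : P} (h : Perp a b) : orderSign a b = 0 := by
  rcases zmod_three_cases (orderSign a b) with h' | h' | h'
  · exact h'
  · exact absurd (orderSign_eq_one.1 h').le h.1
  · exact absurd (orderSign_eq_neg_one.1 h').le h.2

theorem perp_iff_orderSign {a b : P} : Perp a b ↔ a ≠ b ∧ orderSign a b = 0 := by
  refine ⟨fun h => ⟨fun e => h.1 e.le, orderSign_eq_zero_of_perp h⟩, fun ⟨hne, h⟩ => ⟨?_, ?_⟩⟩
  · intro hle
    rw [orderSign_eq_one.2 (lt_of_le_of_ne hle hne)] at h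
    exact absurd h (by decide)
  · intro hle
    rw [orderSign_eq_neg_one.2 (lt_of_le_of_ne hle hne.symm)] at h
    exact absurd h (by decide)

theorem orderSign_trans {a b c : P} (h₁ : orderSign a b = 1) (h₂ : orderSign b c = 1) :
    orderSign a c = 1 :=
  orderSign_eq_one.2 ((orderSign_eq_one.1 h₁).trans (orderSign_eq_one.1 h₂))

theorem orderSign_trans_neg {a b c : P} (h₁ : orderSign a b = -1) (h₂ : orderSign b c = -1) :
    orderSign a c = -1 :=
  orderSign_eq_neg_one.2 ((orderSign_eq_neg_one.1 h₂).trans (orderSign_eq_neg_one.1 h₁))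

theorem cyc_iff_orderSign (a b c : P) :
    Cyc a b c ↔ orderSign a b + orderSign b c + orderSign c a = 1 := by
  by_cases hab : a = b
  · subst hab
    have hp : ¬ Perp a a := fun h => h.1 le_rfl
    have : ¬ Cyc a a c := by
      rintro (⟨h, -⟩ | ⟨h, h'⟩ | ⟨-, h⟩ | ⟨h, -⟩ | ⟨-, h, -⟩ | ⟨-, h, -⟩)
      exacts [h.false, h.asymm h', h.false, h.false, hp h, hp h]
    rw [orderSign_self, orderSign_swap a c]
    simp [this]
  by_cases hbc : b = c
  · subst hbc
    have hp : ¬ Perp b b := fun h => h.1 le_rfl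
    have : ¬ Cyc a b b := by
      rintro (⟨-, h⟩ | ⟨h, -⟩ | ⟨h, h'⟩ | ⟨-, -, h⟩ | ⟨h, -⟩ | ⟨-, -, h⟩)
      exacts [h.false, h.false, h.asymm h', hp h, h.false, hp h]
    rw [orderSign_self, orderSign_swap a b]
    simp [this]
  by_cases hca : c = a
  · subst hca
    have hp : ¬ Perp c c := fun h => h.1 le_rfl
    have : ¬ Cyc c b c := by
      rintro (⟨h, h'⟩ | ⟨-, h⟩ | ⟨h, -⟩ | ⟨-, h, -⟩ | ⟨-, -, h⟩ | ⟨h, -⟩)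
      exacts [h.asymm h', h.false, h.false, hp h, hp h, h.false]
    rw [orderSign_self, orderSign_swap c b]
    simp [this]
  have h₁ := @orderSign_trans_neg P _ a b c
  have h₂ := @orderSign_trans_neg P _ b c a
  have h₃ := @orderSign_trans_neg P _ c a b
  have p₁ := @orderSign_trans P _ a b c
  have p₂ := @orderSign_trans P _ b c a
  have p₃ := @orderSign_trans P _ c a b
  simp only [Cyc, perp_iff_orderSign, ← orderSign_eq_one, orderSign_swap a b,
    orderSign_swap b c, orderSign_swap c a, ne_eq, hab, hbc, hca, Ne.symm hab, Ne.symm hbc,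
    Ne.symm hca, not_false_eq_true, true_and] at h₁ h₂ h₃ p₁ p₂ p₃ ⊢
  generalize orderSign a b = x at *
  generalize orderSign b c = y at *
  generalize orderSign c a = z at *
  rcases zmod_three_cases x with rfl | rfl | rfl <;>
    rcases zmod_three_cases y with rfl | rfl | rfl <;>
    rcases zmod_three_cases z with rfl | rfl | rfl <;>
    revert h₁ h₂ h₃ p₁ p₂ p₃ <;> decide

theorem preserves_cyc_iff_exists_shift (f : Equiv.Perm P) :
    Preserves3 (⇑f) Cyc ↔
      ∃ s : P → ZMod 3, ∀ a b, orderSign (f a) (f b) = orderSign a b + s a - s b := by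
  constructor
  · intro h
    rcases isEmpty_or_nonempty P with hP | ⟨⟨p⟩⟩
    · exact ⟨fun _ => 0, fun a => isEmptyElim a⟩
    refine ⟨fun a => orderSign (f a) (f p) - orderSign a p, fun a b => ?_⟩
    have h₁ := h a b p
    have h₂ := h p b a
    rw [cyc_iff_orderSign, cyc_iff_orderSign] at h₁ h₂
    rw [orderSign_swap a p, orderSign_swap (f a) (f p)] at h₁
    rw [orderSign_swap b p, orderSign_swap (f b) (f p), orderSign_swap a b,
      orderSign_swap (f a) (f b)] at h₂
    have key : ∀ u v : ZMod 3, (u = 1 ↔ v = 1) → (-u = 1 ↔ -v = 1) → u = v := by decide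
    have e := key _ _ h₁ (by convert h₂ using 2 <;> ring)
    linear_combination -e
  · rintro ⟨s, hs⟩ a b c
    rw [cyc_iff_orderSign, cyc_iff_orderSign, hs, hs, hs]
    ring_nf

theorem exists_shift_of_isRotation {f : Equiv.Perm P} (hf : IsRotation f) :
    ∃ s : P → ZMod 3, ∀ a b, orderSign (f a) (f b) = orderSign a b + s a - s b := by
  classical
  obtain ⟨X, Y, Z, hcov, hXY, hXZ, hYZ, hX, hZ, hlt, bX, bY, bZ, hfXZ, hfXY, hfYZ⟩ := hf
  have hid : ∀ W : Set P, BehavesLikeId (⇑f) W → ∀ a ∈ W, ∀ b ∈ W,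
      orderSign (f a) (f b) = orderSign a b := by
    intro W hW a ha b hb
    by_cases hab : a = b
    · rw [hab, orderSign_self, orderSign_self]
    rcases zmod_three_cases (orderSign a b) with h | h | h
    · rw [h, orderSign_eq_zero_of_perp ((hW a ha b hb).2 (perp_iff_orderSign.2 ⟨hab, h⟩))]
    · rw [h, orderSign_eq_one.2 ((hW a ha b hb).1 (orderSign_eq_one.1 h))]
    · rw [h, orderSign_eq_neg_one.2 ((hW b hb a ha).1 (orderSign_eq_neg_one.1 h))]
  have hdown : ∀ a b : P, a ≠ b → ¬ b < a →
      ((f b < f a ↔ Perp a b) ∧ (Perp (f a) (f b) ↔ a < b)) →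
      orderSign (f a) (f b) = orderSign a b - 1 := by
    intro a b hne hba h
    rcases zmod_three_cases (orderSign a b) with h' | h' | h'
    · rw [h', orderSign_eq_neg_one.2 (h.1.2 (perp_iff_orderSign.2 ⟨hne, h'⟩))]
      decide
    · rw [h', orderSign_eq_zero_of_perp (h.2.2 (orderSign_eq_one.1 h'))]
      decide
    · exact absurd (orderSign_eq_neg_one.1 h') hba
  have hneg : ∀ a b : P, ∀ t : ZMod 3, orderSign (f a) (f b) = orderSign a b + t →
      orderSign (f b) (f a) = orderSign b a - t := by
    intro a b t h
    rw [orderSign_swap (f a) (f b), h, orderSign_swap a b]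
    ring
  have hXY' : ∀ a ∈ X, ∀ b ∈ Y, orderSign (f a) (f b) = orderSign a b - 1 := fun a ha b hb =>
    hdown a b (hXY.ne_of_mem ha hb)
      (fun h => hXY.ne_of_mem (hX h.le ha) hb rfl) (hfXY a ha b hb)
  have hYZ' : ∀ a ∈ Y, ∀ b ∈ Z, orderSign (f a) (f b) = orderSign a b - 1 := fun a ha b hb =>
    hdown a b (hYZ.ne_of_mem ha hb)
      (fun h => hYZ.ne_of_mem ha (hZ h.le hb) rfl) (hfYZ a ha b hb)
  have hXZ' : ∀ a ∈ X, ∀ b ∈ Z, orderSign (f a) (f b) = orderSign a b - 2 := by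
    intro a ha b hb
    rw [orderSign_eq_one.2 (hlt a ha b hb), orderSign_eq_neg_one.2 (hfXZ a ha b hb)]
    decide
  let s : P → ZMod 3 := fun p => if p ∈ X then 0 else if p ∈ Y then 1 else 2
  have sX : ∀ p ∈ X, s p = 0 := fun p hp => if_pos hp
  have sY : ∀ p ∈ Y, s p = 1 := fun p hp => by
    simp [s, hp, hXY.notMem_of_mem_right hp]
  have sZ : ∀ p ∈ Z, s p = 2 := fun p hp => by
    simp [s, hXZ.notMem_of_mem_right hp, hYZ.notMem_of_mem_right hp]
  refine ⟨s, fun a b => ?_⟩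
  rcases hcov a with ha | ha | ha <;> rcases hcov b with hb | hb | hb
  · rw [hid X bX a ha b hb, sX a ha, sX b hb]; ring
  · rw [hXY' a ha b hb, sX a ha, sY b hb]; ring
  · rw [hXZ' a ha b hb, sX a ha, sZ b hb]; ring
  · rw [hneg b a (-1) (by rw [hXY' b hb a ha]; ring), sY a ha, sX b hb]; ring
  · rw [hid Y bY a ha b hb, sY a ha, sY b hb]; ring
  · rw [hYZ' a ha b hb, sY a ha, sZ b hb]; ring
  · rw [hneg b a (-2) (by rw [hXZ' b hb a ha]; ring), sZ a ha, sX b hb]; ring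
  · rw [hneg b a (-1) (by rw [hYZ' b hb a ha]; ring), sZ a ha, sY b hb]; ring
  · rw [hid Z bZ a ha b hb, sZ a ha, sZ b hb]; ring

section Shift

variable {f : Equiv.Perm P} {s : P → ZMod 3}

theorem lt_iff_of_shift_eq (hs : ∀ a b, orderSign (f a) (f b) = orderSign a b + s a - s b)
    {a b : P} (h : s a = s b) : f a < f b ↔ a < b := by
  rw [← orderSign_eq_one, ← orderSign_eq_one, hs, h, add_sub_cancel_right]

theorem orderSign_of_shift_succ
    (hs : ∀ a b, orderSign (f a) (f b) = orderSign a b + s a - s b)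
    {a b : P} (h : s b = s a + 1) : orderSign (f a) (f b) = orderSign a b - 1 := by
  rw [hs, h]
  ring

theorem lt_iff_gt_of_shift_succ
    (hs : ∀ a b, orderSign (f a) (f b) = orderSign a b + s a - s b)
    {a b : P} (h : s b = s a + 1) : f a < f b ↔ b < a := by
  have key : ∀ x : ZMod 3, x - 1 = 1 ↔ x = -1 := by decide
  rw [← orderSign_eq_one, ← orderSign_eq_neg_one, orderSign_of_shift_succ hs h, key]

theorem gt_iff_orderSign_eq_zero_of_shift_succ
    (hs : ∀ a b, orderSign (f a) (f b) = orderSign a b + s a - s b)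
    {a b : P} (h : s b = s a + 1) : f b < f a ↔ orderSign a b = 0 := by
  rw [← orderSign_eq_neg_one, orderSign_of_shift_succ hs h, sub_eq_neg_self]

theorem lt_of_shift_eq_left (hs : ∀ a b, orderSign (f a) (f b) = orderSign a b + s a - s b)
    {a a' b : P} (hb : s b = s a + 1) (ha : s a' = s a) (h : b < a) : b < a' := by
  have hb' : s b = s a' + 1 := by rw [hb, ha]
  have hf := (lt_iff_gt_of_shift_succ hs hb).2 h
  rcases zmod_three_cases (orderSign a' b) with h' | h' | h'
  · have := (gt_iff_orderSign_eq_zero_of_shift_succ hs hb').2 h'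
    exact h.trans ((lt_iff_of_shift_eq hs ha.symm).1 (hf.trans this))
  · have := (lt_iff_of_shift_eq hs ha).2 ((orderSign_eq_one.1 h').trans h)
    exact (lt_iff_gt_of_shift_succ hs hb').1 (this.trans hf)
  · exact orderSign_eq_neg_one.1 h'

theorem lt_of_shift_eq_right (hs : ∀ a b, orderSign (f a) (f b) = orderSign a b + s a - s b)
    {a b b' : P} (hb : s b = s a + 1) (hbb' : s b' = s b) (h : b < a) : b' < a := by
  have hb' : s b' = s a + 1 := by rw [hbb', hb]
  have hf := (lt_iff_gt_of_shift_succ hs hb).2 h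
  rcases zmod_three_cases (orderSign a b') with h' | h' | h'
  · have := (gt_iff_orderSign_eq_zero_of_shift_succ hs hb').2 h'
    exact ((lt_iff_of_shift_eq hs hbb').1 (this.trans hf)).trans h
  · have := (lt_iff_of_shift_eq hs hbb'.symm).2 (h.trans (orderSign_eq_one.1 h'))
    exact (lt_iff_gt_of_shift_succ hs hb').1 (hf.trans this)
  · exact orderSign_eq_neg_one.1 h'

/-- Between consecutive level sets of the shift, either all pairs are reversed or none is. -/
theorem all_lt_or_none_lt (hs : ∀ a b, orderSign (f a) (f b) = orderSign a b + s a - s b)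
    (i : ZMod 3) :
    (∀ a b, s a = i → s b = i + 1 → b < a) ∨ (∀ a b, s a = i → s b = i + 1 → ¬ b < a) := by
  by_contra! h
  obtain ⟨⟨a', b', ha', hb', h'⟩, a, b, ha, hb, hlt⟩ := h
  refine h' (lt_of_shift_eq_right (b := b) hs (by rw [hb, ha']) (by rw [hb, hb']) ?_)
  exact lt_of_shift_eq_left hs (by rw [hb, ha]) (by rw [ha', ha]) hlt

theorem not_lt_of_lt_of_shift (hs : ∀ a b, orderSign (f a) (f b) = orderSign a b + s a - s b)
    {a b c : P} (hb : s b = s a + 1) (hc : s c = s b + 1) (ha : s a = s c + 1)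
    (hba : b < a) : ¬ c < b := by
  intro hcb
  have hf := ((lt_iff_gt_of_shift_succ hs hb).2 hba).trans ((lt_iff_gt_of_shift_succ hs hc).2 hcb)
  rw [gt_iff_orderSign_eq_zero_of_shift_succ hs ha, orderSign_eq_one.2 (hcb.trans hba)] at hf
  exact absurd hf (by decide)

theorem exists_lt_of_shift (hs : ∀ a b, orderSign (f a) (f b) = orderSign a b + s a - s b)
    {a b c : P} (hb : s b = s a + 1) (hc : s c = s b + 1) (ha : s a = s c + 1) :
    b < a ∨ c < b ∨ a < c := by
  by_contra! h
  obtain ⟨hba, hcb, hac⟩ := h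
  have pos : ∀ {x y z : P}, s z = s y + 1 → s x = s z + 1 → ¬ x < z →
      orderSign x y = 1 → orderSign y z ≠ 1 := fun _ _ h h₁ h₂ =>
    h ((orderSign_eq_one.1 h₁).trans (orderSign_eq_one.1 h₂))
  have zero : ∀ {x y z : P}, s y = s x + 1 → s z = s y + 1 → s x = s z + 1 → ¬ x < z →
      orderSign x y = 0 → orderSign y z ≠ 0 := fun hy hz hx h h₁ h₂ =>
    h ((lt_iff_gt_of_shift_succ hs hx).1
      (((gt_iff_orderSign_eq_zero_of_shift_succ hs hz).2 h₂).trans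
        ((gt_iff_orderSign_eq_zero_of_shift_succ hs hy).2 h₁)))
  rw [← orderSign_eq_neg_one] at hba hcb
  have hca : orderSign c a ≠ -1 := fun h => hac (orderSign_eq_neg_one.1 h)
  rcases zmod_three_cases (orderSign a b) with h₁ | h₁ | h₁
  · rcases zmod_three_cases (orderSign b c) with h₂ | h₂ | h₂
    · exact zero hb hc ha hac h₁ h₂
    · rcases zmod_three_cases (orderSign c a) with h₃ | h₃ | h₃
      · exact zero ha hb hc (fun h => hcb (orderSign_eq_neg_one.2 h)) h₃ h₁
      · exact pos ha hb (fun h => hba (orderSign_eq_neg_one.2 h)) h₂ h₃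
      · exact hca h₃
    · exact hcb h₂
  · rcases zmod_three_cases (orderSign b c) with h₂ | h₂ | h₂
    · rcases zmod_three_cases (orderSign c a) with h₃ | h₃ | h₃
      · exact zero hc ha hb (fun h => hba (orderSign_eq_neg_one.2 h)) h₂ h₃
      · exact pos hb hc (fun h => hcb (orderSign_eq_neg_one.2 h)) h₃ h₁
      · exact hca h₃
    · exact pos hc ha hac h₁ h₂
    · exact hcb h₂
  · exact hba h₁

/-- Some level set lies above the next one, and no other consecutive pair of level sets has a
reversed pair. -/
theorem exists_top_level (hs : ∀ a b, orderSign (f a) (f b) = orderSign a b + s a - s b) :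
    ∃ i : ZMod 3, (∀ a b, s a = i → s b = i + 1 → b < a) ∧
      (∀ a b, s a = i + 1 → s b = i + 2 → ¬ b < a) ∧
      (∀ a b, s a = i + 2 → s b = i → ¬ b < a) := by
  have e₁ : ∀ i : ZMod 3, i + 1 + 1 = i + 2 := by decide
  have e₂ : ∀ i : ZMod 3, i + 2 + 1 = i := by decide
  have e₃ : ∀ i : ZMod 3, i + 1 + 2 = i := by decide
  by_cases hne : ∀ i, ∃ a, s a = i
  · have top : ∃ i : ZMod 3, ∀ a b, s a = i → s b = i + 1 → b < a := by
      by_contra! hno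
      have hG : ∀ a b, s b = s a + 1 → ¬ b < a := by
        intro a b hb
        rcases all_lt_or_none_lt hs (s a) with h | h
        · obtain ⟨a', b', ha', hb', h'⟩ := hno (s a)
          exact absurd (h a' b' ha' hb') h'
        · exact h a b rfl hb
      obtain ⟨a, ha⟩ := hne 0
      obtain ⟨b, hb⟩ := hne 1
      obtain ⟨c, hc⟩ := hne 2
      have hab : s b = s a + 1 := by rw [ha, hb]; decide
      have hbc : s c = s b + 1 := by rw [hc, hb]; decide
      have hca : s a = s c + 1 := by rw [ha, hc]; decide
      rcases exists_lt_of_shift hs hab hbc hca with h | h | h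
      exacts [hG _ _ hab h, hG _ _ hbc h, hG _ _ hca h]
    obtain ⟨i, hi⟩ := top
    refine ⟨i, hi, fun b c hb hc hcb => ?_, fun c a hc ha hac => ?_⟩
    · obtain ⟨a, ha⟩ := hne i
      exact not_lt_of_lt_of_shift hs (by rw [ha, hb]) (by rw [hb, hc, e₁])
        (by rw [ha, hc, e₂]) (hi a b ha hb) hcb
    · obtain ⟨b, hb⟩ := hne (i + 1)
      exact not_lt_of_lt_of_shift hs (by rw [ha, hc, e₂]) (by rw [ha, hb])
        (by rw [hb, hc, e₁]) hac (hi a b ha hb)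
  · push Not at hne
    obtain ⟨i, hi⟩ := hne
    rcases all_lt_or_none_lt hs (i + 1) with h | h
    · refine ⟨i + 1, h, fun a b _ hb => ?_, fun a b ha _ => ?_⟩
      · exact absurd (hb.trans (e₃ i)) (hi b)
      · exact absurd (ha.trans (e₃ i)) (hi a)
    · refine ⟨i, fun a b ha => absurd ha (hi a), ?_, fun a b _ hb => absurd hb (hi b)⟩
      rwa [e₁] at h

theorem isRotation_of_shift
    (hs : ∀ a b, orderSign (f a) (f b) = orderSign a b + s a - s b) : IsRotation f := by
  have e₁ : ∀ i : ZMod 3, i + 1 + 1 = i + 2 := by decide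
  have e₂ : ∀ i : ZMod 3, i + 2 + 1 = i := by decide
  have n₁ : ∀ i : ZMod 3, i + 1 ≠ i + 2 := by decide
  have n₂ : ∀ i : ZMod 3, i + 1 ≠ i := by decide
  have n₃ : ∀ i : ZMod 3, i + 2 ≠ i := by decide
  have cover : ∀ i j : ZMod 3, j = i + 1 ∨ j = i + 2 ∨ j = i := by decide
  obtain ⟨i, hZX, hXY, hYZ⟩ := exists_top_level hs
  have disj : ∀ {j k : ZMod 3}, j ≠ k → Disjoint {p | s p = j} {p | s p = k} :=
    fun hjk => Set.disjoint_left.2 fun p hj hk => hjk (hj.symm.trans hk)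
  have same : ∀ j : ZMod 3, BehavesLikeId (⇑f) {p | s p = j} := by
    intro j x hx x' hx'
    have e : s x = s x' := Eq.trans hx (Eq.symm hx')
    refine ⟨(lt_iff_of_shift_eq hs e).2, fun h => ?_⟩
    rw [perp_iff_orderSign] at h ⊢
    rw [hs, e, add_sub_cancel_right]
    exact ⟨f.injective.ne h.1, h.2⟩
  have step : ∀ {x y : P}, s y = s x + 1 →
      (f y < f x ↔ Perp x y) ∧ (Perp (f x) (f y) ↔ x < y) := by
    intro x y h
    have hne : x ≠ y := by
      rintro rfl
      exact n₂ _ h.symm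
    rw [gt_iff_orderSign_eq_zero_of_shift_succ hs h, perp_iff_orderSign, perp_iff_orderSign,
      orderSign_of_shift_succ hs h, sub_eq_zero, orderSign_eq_one]
    exact ⟨(and_iff_right hne).symm, and_iff_right (f.injective.ne hne)⟩
  refine ⟨{p | s p = i + 1}, {p | s p = i + 2}, {p | s p = i}, fun p => cover i (s p),
    disj (n₁ i), disj (n₂ i), disj (n₃ i), ?_, ?_, fun x hx z hz => hZX z x hz hx,
    same _, same _, same _, ?_, ?_, ?_⟩
  · intro x y hyx hx
    rcases hyx.eq_or_lt with rfl | hlt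
    · exact hx
    rcases cover i (s y) with h | h | h
    · exact h
    · exact absurd hlt (hXY x y hx h)
    · exact absurd hlt (hZX y x h hx).asymm
  · intro z y hzy hz
    rcases hzy.eq_or_lt with rfl | hlt
    · exact hz
    rcases cover i (s y) with h | h | h
    · exact absurd hlt (hZX z y hz h).asymm
    · exact absurd hlt (hYZ y z h hz)
    · exact h
  · intro x hx z hz
    exact (lt_iff_gt_of_shift_succ hs (Eq.trans hx (congrArg (· + 1) (Eq.symm hz)))).2
      (hZX z x hz hx)
  · intro x hx y hy
    exact step (Eq.trans hy ((e₁ i).symm.trans (congrArg (· + 1) (Eq.symm hx))))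
  · intro y hy z hz
    exact step (Eq.trans hz ((e₂ i).symm.trans (congrArg (· + 1) (Eq.symm hy))))

end Shift

/-- A permutation preserves `Cyc` iff it is a rotation. -/
theorem preserves_cyc_iff_rotation [Countable P] [Infinite P]
    (hU : IsUniversal P) (hH : IsHomogeneous P) (f : Equiv.Perm P) :
    Preserves3 (⇑f) Cyc ↔ IsRotation f := by
  rw [preserves_cyc_iff_exists_shift]
  exact ⟨fun ⟨_, hs⟩ => isRotation_of_shift hs, exists_shift_of_isRotation⟩
end

section
/- Let f be a permutation of P which preserves the relation Pari but is not a rotation of P. Then f switches Cyc and Cyc': for all (a, b, c) ∈ P³, (a, b, c) ∈ Cyc if and only if (f(a), f(b), f(c)) ∈ Cyc'. -/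
variable {P : Type} [PartialOrder P]

/-- One-point extension: over a finite set `F`, there is a point lying strictly above the
elements of `F` that are below some element of `L`, and incomparable to all others. -/
theorem exists_extension (hU : IsUniversal P) (hH : IsHomogeneous P) (F : Finset P) (L : Set P) :
    ∃ v : P, ∀ x ∈ F, ((∃ l ∈ L, x ≤ l) → x < v) ∧ ((∀ l ∈ L, ¬ x ≤ l) → Perp x v) := by
  classical
  let le : Option F → Option F → Prop := fun p q =>
    match p, q with
    | some x, some y => x ≤ y
    | some x, none => ∃ l ∈ L, (x : P) ≤ l
    | none, some _ => False
    | none, none => True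
  let : PartialOrder (Option F) :=
    { le := le
      lt := fun p q => le p q ∧ ¬ le q p
      le_refl := by rintro (_ | x) <;> simp [le]
      le_trans := by
        rintro (_ | x) (_ | y) (_ | z) <;> simp only [le] <;> try tauto
        · rintro h ⟨l, hl, hyl⟩
          exact ⟨l, hl, le_trans h hyl⟩
        · exact le_trans
      le_antisymm := by
        rintro (_ | x) (_ | y) <;> simp only [le] <;> try tauto
        intro h h'
        rw [le_antisymm h h'] }
  obtain ⟨e⟩ := hU (Option F)
  let j : (F : Set P) ↪o P := OrderEmbedding.ofMapLEIff (fun x => e (some x)) (by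
    intro x y
    rw [e.le_iff_le]
    exact Iff.rfl)
  have hS : Set.range j = ((Set.toFinset (Set.range j) : Finset P) : Set P) := by simp
  obtain ⟨g, hg⟩ := hH F (Set.toFinset (Set.range j)) (j.orderIso.trans (OrderIso.setCongr _ _ hS))
  have hg' : ∀ x : F, g x = e (some x) := fun x => hg x
  refine ⟨g.symm (e none), fun x hx => ?_⟩
  have h1 : x ≤ g.symm (e none) ↔ ∃ l ∈ L, x ≤ l := by
    rw [g.le_symm_apply, hg' ⟨x, hx⟩, e.le_iff_le]
    exact Iff.rfl
  have h2 : ¬ g.symm (e none) ≤ x := by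
    rw [g.symm_apply_le, hg' ⟨x, hx⟩, e.le_iff_le]
    exact id
  refine ⟨fun h => lt_of_le_not_ge (h1.2 h) h2, fun h => ⟨fun h' => ?_, h2⟩⟩
  obtain ⟨l, hl, hxl⟩ := h1.1 h'
  exact h l hl hxl

theorem Perp.symm {a b : P} (h : Perp a b) : Perp b a := ⟨h.2, h.1⟩

open Classical in
/-- The comparison of `a` and `b`, valued in `ℤ/3`: `1` if `a < b`, `-1` if `b < a`, `0` otherwise. -/
noncomputable def sgn (a b : P) : ZMod 3 := if a < b then 1 else if b < a then -1 else 0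

theorem sgn_eq_one {a b : P} : sgn a b = 1 ↔ a < b := by
  unfold sgn
  split_ifs with h h'
  · simp [h]
  · simp only [h, iff_false]; decide
  · simp only [h, iff_false]; decide

theorem sgn_eq_neg_one {a b : P} : sgn a b = -1 ↔ b < a := by
  unfold sgn
  split_ifs with h h'
  · simp only [h.asymm, iff_false]; decide
  · simp [h']
  · simp only [h', iff_false]; decide

theorem sgn_self (a : P) : sgn a a = 0 := by simp [sgn]

theorem sgn_comm (a b : P) : sgn b a = - sgn a b := by
  unfold sgn
  split_ifs with h h'
  · exact absurd h' h.asymm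
  all_goals simp

theorem perp_iff {a b : P} : Perp a b ↔ a ≠ b ∧ sgn a b = 0 := by
  unfold sgn Perp
  constructor
  · rintro ⟨h1, h2⟩
    exact ⟨fun h => h1 h.le, by
      rw [if_neg fun h : a < b => h1 h.le, if_neg fun h : b < a => h2 h.le]⟩
  · rintro ⟨hne, h⟩
    split_ifs at h with h1 h2
    · exact absurd h (by decide)
    · exact absurd h (by decide)
    · exact ⟨fun h => h1 (lt_of_le_of_ne h hne), fun h => h2 (lt_of_le_of_ne h hne.symm)⟩

theorem Perp.sgn_eq {a b : P} (h : Perp a b) : sgn a b = 0 := (perp_iff.1 h).2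

/-- The coboundary of `sgn`. -/
noncomputable def cocycle (a b c : P) : ZMod 3 := sgn a b + sgn b c + sgn c a

/-- The condition on `p = sgn a b`, `q = sgn b c`, `r = sgn c a` expressing transitivity. -/
abbrev Transitive3 (p q r : ZMod 3) : Prop :=
  (p = 1 → q = 1 → r = -1) ∧ (q = 1 → r = 1 → p = -1) ∧ (r = 1 → p = 1 → q = -1) ∧
  (p = -1 → q = -1 → r = 1) ∧ (q = -1 → r = -1 → p = 1) ∧ (r = -1 → p = -1 → q = 1)

theorem transitive3_sgn (a b c : P) : Transitive3 (sgn a b) (sgn b c) (sgn c a) := by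
  simp only [Transitive3, sgn_eq_one, sgn_eq_neg_one]
  exact ⟨fun h h' => h.trans h', fun h h' => h.trans h', fun h h' => h.trans h',
    fun h h' => h'.trans h, fun h h' => h'.trans h, fun h h' => h'.trans h⟩

theorem cyc_iff (a b c : P) : Cyc a b c ↔ cocycle a b c = 1 := by
  have key : ∀ p q r : ZMod 3, Transitive3 p q r →
      (((p = 1 ∧ q = 1) ∨ (q = 1 ∧ r = 1) ∨ (r = 1 ∧ p = 1) ∨ (p = 1 ∧ r = 0 ∧ q = 0) ∨
        (q = 1 ∧ p = 0 ∧ r = 0) ∨ (r = 1 ∧ p = 0 ∧ q = 0)) ↔ p + q + r = 1) := by decide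
  by_cases hdeg : a = b ∨ b = c ∨ c = a
  · have hco : cocycle a b c = 0 := by
      rcases hdeg with rfl | rfl | rfl
      · simp [cocycle, sgn_self, sgn_comm a c]
      · simp [cocycle, sgn_self, sgn_comm a b]
      · simp [cocycle, sgn_self, sgn_comm b c]
    rw [hco]
    simp only [zero_ne_one, iff_false]
    rcases hdeg with rfl | rfl | rfl
    all_goals
      simp only [Cyc, lt_irrefl, Perp, le_refl]
      rintro (h | h | h | h | h | h)
      all_goals first | exact h.1.asymm h.2 | simp at h
  obtain ⟨hab, hbc, hca⟩ : a ≠ b ∧ b ≠ c ∧ c ≠ a := by tauto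
  have hp : ∀ x y : P, x ≠ y → (Perp x y ↔ sgn x y = 0) := fun x y h => by simp [perp_iff, h]
  rw [cocycle, ← key _ _ _ (transitive3_sgn a b c), Cyc, hp c a hca, hp a b hab,
    hp c b (Ne.symm hbc), hp a c (Ne.symm hca), hp b a (Ne.symm hab), hp b c hbc, sgn_comm a b,
    sgn_comm b c, sgn_comm c a]
  simp only [sgn_eq_one, neg_eq_zero]

theorem pari_iff {a b c : P} (hab : a ≠ b) (hbc : b ≠ c) (hca : c ≠ a) :
    Pari a b c ↔ cocycle a b c = 0 := by
  have key : ∀ p q r : ZMod 3, Transitive3 p q r →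
      (((p = 0 ∧ q = 0 ∧ r = 0) ∨ (p = 1 ∧ r = -1 ∧ q = 0) ∨ (p = -1 ∧ q = 1 ∧ r = 0) ∨
        (r = 1 ∧ q = -1 ∧ p = 0) ∨ (p = -1 ∧ r = 1 ∧ q = 0) ∨ (p = 1 ∧ q = -1 ∧ r = 0) ∨
        (r = -1 ∧ q = 1 ∧ p = 0)) ↔ p + q + r = 0) := by decide
  have hp : ∀ x y : P, x ≠ y → (Perp x y ↔ sgn x y = 0) := fun x y h => by simp [perp_iff, h]
  rw [cocycle, ← key _ _ _ (transitive3_sgn a b c), Pari, hp a b hab, hp a c (Ne.symm hca),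
    hp b c hbc, sgn_comm c a]
  simp only [sgn_eq_one, sgn_eq_neg_one, neg_eq_zero]

theorem cocycle_map_eq_zero_iff {f : Equiv.Perm P} (hpar : Preserves3 (⇑f) Pari) (a b c : P) :
    cocycle a b c = 0 ↔ cocycle (f a) (f b) (f c) = 0 := by
  by_cases hab : a = b
  · subst hab; simp [cocycle, sgn_self, sgn_comm a c, sgn_comm (f a) (f c)]
  by_cases hbc : b = c
  · subst hbc; simp [cocycle, sgn_self, sgn_comm a b, sgn_comm (f a) (f b)]
  by_cases hca : c = a
  · subst hca; simp [cocycle, sgn_self, sgn_comm b c, sgn_comm (f b) (f c)]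
  rw [← pari_iff hab hbc hca, hpar, pari_iff (by simpa) (by simpa) (by simpa)]

theorem cocycle_rotate (a b c : P) : cocycle b c a = cocycle a b c := by
  unfold cocycle; ring

theorem cocycle_swap (a b c : P) : cocycle c b a = - cocycle a b c := by
  unfold cocycle
  rw [sgn_comm b c, sgn_comm a b, sgn_comm c a]; ring

/-- If `f` preserves the cocycle, it changes `sgn` by the coboundary of some `φ`. -/
theorem exists_potential {f : Equiv.Perm P} [Nonempty P]
    (h : ∀ a b c, cocycle (f a) (f b) (f c) = cocycle a b c) :
    ∃ φ : P → ZMod 3, ∀ a b, sgn (f a) (f b) = sgn a b + φ b - φ a := by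
  obtain ⟨o⟩ := ‹Nonempty P›
  refine ⟨fun x => sgn (f o) (f x) - sgn o x, fun a b => ?_⟩
  have := h o a b
  unfold cocycle at this
  rw [sgn_comm o b, sgn_comm (f o) (f b)] at this
  linear_combination this

/-- Two points have a common strict upper bound. -/
theorem exists_gt_gt (hU : IsUniversal P) (hH : IsHomogeneous P) (a b : P) :
    ∃ c, a < c ∧ b < c := by
  classical
  obtain ⟨v, hv⟩ := exists_extension hU hH {a, b} {a, b}
  exact ⟨v, (hv a (by simp)).1 ⟨a, by simp, le_rfl⟩, (hv b (by simp)).1 ⟨b, by simp, le_rfl⟩⟩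

theorem exists_perp (hU : IsUniversal P) (hH : IsHomogeneous P) (F : Finset P) :
    ∃ c, ∀ x ∈ F, Perp x c := by
  obtain ⟨v, hv⟩ := exists_extension hU hH F ∅
  exact ⟨v, fun x hx => (hv x hx).2 (by simp)⟩

/-- A potential `φ` relating `f` to the order, whose level sets are ordered correctly, makes `f`
a rotation. -/
theorem isRotation_of_potential {f : Equiv.Perm P} {φ : P → ZMod 3}
    (hφ : ∀ a b, sgn (f a) (f b) = sgn a b + φ b - φ a)
    (hX : ∀ p q, p < q → φ q = 0 → φ p = 0) (hZ : ∀ p q, p < q → φ p = 1 → φ q = 1)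
    (hXZ : ∀ p q, φ p = 0 → φ q = 1 → p < q) : IsRotation f := by
  have hid : ∀ i, BehavesLikeId (⇑f) {p | φ p = i} := by
    intro i x hx y hy
    have h : sgn (f x) (f y) = sgn x y := by
      rw [hφ, show φ x = i from hx, show φ y = i from hy]; ring
    rw [← sgn_eq_one, ← sgn_eq_one, perp_iff, perp_iff, h]
    exact ⟨id, fun h => ⟨by simpa using h.1, h.2⟩⟩
  have hdisj : ∀ i j : ZMod 3, i ≠ j → Disjoint {p : P | φ p = i} {p | φ p = j} := by
    intro i j hij
    rw [Set.disjoint_left]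
    intro p hp hp'
    exact hij (hp.symm.trans hp')
  have hshift : ∀ x y, φ y = φ x - 1 →
      (f y < f x ↔ Perp x y) ∧ (Perp (f x) (f y) ↔ x < y) := by
    intro x y h
    have hne : x ≠ y := by
      rintro rfl
      revert h
      generalize φ x = i
      revert i
      decide
    have hs : sgn (f x) (f y) = sgn x y - 1 := by rw [hφ, h]; ring
    rw [← sgn_eq_neg_one, perp_iff, perp_iff, ← sgn_eq_one, hs]
    simp only [ne_eq, EmbeddingLike.apply_eq_iff_eq, hne, not_false_eq_true, true_and]
    exact ⟨by simp, sub_eq_zero⟩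
  refine ⟨{p | φ p = 0}, {p | φ p = 2}, {p | φ p = 1}, ?_, hdisj _ _ (by decide),
    hdisj _ _ (by decide), hdisj _ _ (by decide), ?_, ?_, fun x hx z hz => hXZ x z hx hz,
    hid _, hid _, hid _, ?_, ?_, ?_⟩
  · intro p
    have : ∀ i : ZMod 3, i = 0 ∨ i = 2 ∨ i = 1 := by decide
    exact this (φ p)
  · intro a b hba ha
    rcases hba.eq_or_lt with rfl | h
    · exact ha
    · exact hX _ _ h ha
  · intro a b hab ha
    rcases hab.eq_or_lt with rfl | h
    · exact ha
    · exact hZ _ _ h ha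
  · intro x hx z hz
    rw [← sgn_eq_neg_one, hφ, sgn_eq_one.2 (hXZ x z hx hz), show φ x = 0 from hx,
      show φ z = 1 from hz]
    decide
  · intro x hx y hy
    apply hshift
    rw [show φ x = 0 from hx, show φ y = 2 from hy]; decide
  · intro x hx y hy
    apply hshift
    rw [show φ x = 2 from hx, show φ y = 1 from hy]; decide

theorem isRotation_of_cocycle_eq [Nonempty P] (hU : IsUniversal P) (hH : IsHomogeneous P)
    {f : Equiv.Perm P} (h : ∀ a b c, cocycle (f a) (f b) (f c) = cocycle a b c) :
    IsRotation f := by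
  classical
  obtain ⟨ψ, hψ⟩ := exists_potential h
  have htri : ∀ a b c, Transitive3 (sgn a b + ψ b - ψ a) (sgn b c + ψ c - ψ b)
      (sgn c a + ψ a - ψ c) := by
    intro a b c
    rw [← hψ, ← hψ, ← hψ]
    exact transitive3_sgn _ _ _
  have hup : ∀ a b c, a < b → ψ b = ψ a + 1 → Perp a c → Perp b c → ψ c = ψ a + 2 := by
    intro a b c hab hb hac hbc
    have ht := htri a b c
    rw [sgn_eq_one.2 hab, hbc.sgn_eq, hac.symm.sgn_eq] at ht
    revert hb ht
    generalize ψ a = x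
    generalize ψ b = y
    generalize ψ c = z
    revert x y z
    decide
  have hdown : ∀ a b c, a < b → ψ b = ψ a - 1 → Perp a c → Perp b c → ψ c = ψ a ∨ ψ c = ψ b := by
    intro a b c hab hb hac hbc
    have ht := htri a b c
    rw [sgn_eq_one.2 hab, hbc.sgn_eq, hac.symm.sgn_eq] at ht
    revert hb ht
    generalize ψ a = x
    generalize ψ b = y
    generalize ψ c = z
    revert x y z
    decide
  have hanti : ∀ a b c, Perp a b → Perp b c → Perp a c → ψ a = ψ b ∨ ψ b = ψ c ∨ ψ a = ψ c := by
    intro a b c hab hbc hac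
    have ht := htri a b c
    rw [hab.sgn_eq, hbc.sgn_eq, hac.symm.sgn_eq] at ht
    revert ht
    generalize ψ a = x
    generalize ψ b = y
    generalize ψ c = z
    revert x y z
    decide
  by_cases hinc : ∃ a b, a < b ∧ ψ b = ψ a + 1
  · obtain ⟨a, b, hab, hb⟩ := hinc
    have hcmp : ∀ p q, p < q → ψ q = ψ p ∨ (ψ p = ψ a ∧ ψ q ≠ ψ a) ∨
        (ψ p = ψ a + 2 ∧ ψ q = ψ a + 1) := by
      intro p q hpq
      obtain ⟨c, hc⟩ := exists_perp hU hH {a, b, p, q}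
      have h1 := hup a b c hab hb (hc a (by simp)) (hc b (by simp))
      have h2 := hup p q c hpq
      have h3 := hdown p q c hpq
      simp only [hc p (by simp), hc q (by simp), true_implies, h1] at h2 h3
      revert h2 h3
      generalize ψ a = x
      generalize ψ p = y
      generalize ψ q = z
      revert x y z
      decide
    refine isRotation_of_potential (φ := fun x => ψ x - ψ a)
      (fun x y => by rw [hψ]; ring) ?_ ?_ ?_
    · intro p q hpq
      have := hcmp p q hpq
      revert this
      generalize ψ a = x
      generalize ψ p = y
      generalize ψ q = z
      revert x y z
      decide
    · intro p q hpq
      have := hcmp p q hpq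
      revert this
      generalize ψ a = x
      generalize ψ p = y
      generalize ψ q = z
      revert x y z
      decide
    · intro p q hp hq
      by_contra hpq
      obtain ⟨c, hc⟩ := exists_perp hU hH {a, b, p, q}
      have h1 := hup a b c hab hb (hc a (by simp)) (hc b (by simp))
      have hne : p ≠ q := by
        rintro rfl
        exact absurd (hp.symm.trans hq) (by decide)
      have hqp : ¬ q < p := by
        intro hqp
        have := hcmp q p hqp
        revert this hp hq
        generalize ψ a = x
        generalize ψ p = y
        generalize ψ q = z
        revert x y z
        decide
      have h2 := hanti p q c ⟨fun h => hpq (lt_of_le_of_ne h hne),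
        fun h => hqp (lt_of_le_of_ne h hne.symm)⟩ (hc q (by simp)) (hc p (by simp))
      rw [h1] at h2
      revert h2 hp hq
      generalize ψ a = x
      generalize ψ p = y
      generalize ψ q = z
      revert x y z
      decide
  · have hmiss : ∃ i : ZMod 3, ∀ p q, p < q → ψ p = i + 1 → ψ q ≠ i := by
      by_contra! hall
      obtain ⟨a, b, hab, ha, hb⟩ := hall 0
      obtain ⟨a', b', hab', ha', hb'⟩ := hall 1
      obtain ⟨a'', b'', hab'', ha'', hb''⟩ := hall 2
      obtain ⟨c, hc⟩ := exists_perp hU hH {a, b, a', b', a'', b''}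
      have h1 := hdown a b c hab (by rw [ha, hb]; decide) (hc _ (by simp)) (hc _ (by simp))
      have h2 := hdown a' b' c hab' (by rw [ha', hb']; decide) (hc _ (by simp)) (hc _ (by simp))
      have h3 := hdown a'' b'' c hab'' (by rw [ha'', hb'']; decide) (hc _ (by simp))
        (hc _ (by simp))
      rw [ha, hb] at h1
      rw [ha', hb'] at h2
      rw [ha'', hb''] at h3
      revert h1 h2 h3
      generalize ψ c = x
      revert x
      decide
    obtain ⟨i, hi⟩ := hmiss
    have hcmp : ∀ p q, p < q → ψ q ≠ ψ p + 1 ∧ (ψ p = i + 1 → ψ q ≠ i) := fun p q hpq =>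
      ⟨fun h => hinc ⟨p, q, hpq, h⟩, hi p q hpq⟩
    refine isRotation_of_potential (φ := fun x => ψ x - i)
      (fun x y => by rw [hψ]; ring) ?_ ?_ ?_
    · intro p q hpq
      have := hcmp p q hpq
      revert this
      generalize ψ p = y
      generalize ψ q = z
      clear * -
      revert i y z
      decide
    · intro p q hpq
      have := hcmp p q hpq
      revert this
      generalize ψ p = y
      generalize ψ q = z
      clear * -
      revert i y z
      decide
    · intro p q hp hq
      obtain ⟨c, hpc, hqc⟩ := exists_gt_gt hU hH p q
      have h1 := hcmp p c hpc
      have h2 := hcmp q c hqc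
      exfalso
      revert hp hq h1 h2
      generalize ψ p = y
      generalize ψ q = z
      generalize ψ c = w
      clear * -
      revert i y z w
      decide

/-- A permutation preserving `Pari` multiplies the cocycle by a constant. -/
theorem exists_cocycle_map_eq_mul (hU : IsUniversal P) (hH : IsHomogeneous P) {f : Equiv.Perm P}
    (hpar : Preserves3 (⇑f) Pari) :
    ∃ k : ZMod 3, ∀ a b c, cocycle (f a) (f b) (f c) = k * cocycle a b c := by
  classical
  have hzero : ∀ a b c, cocycle a b c = 0 → cocycle (f a) (f b) (f c) = 0 :=
    fun a b c => (cocycle_map_eq_zero_iff hpar a b c).1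
  have hco : ∀ a b c d, cocycle (f b) (f c) (f d) - cocycle (f a) (f c) (f d) +
      cocycle (f a) (f b) (f d) - cocycle (f a) (f b) (f c) = 0 := by
    intro a b c d
    unfold cocycle
    rw [sgn_comm (f b) (f d), sgn_comm (f a) (f d), sgn_comm (f a) (f c)]
    ring
  -- moving the incomparable point of a triple `a < b`, `c ⊥ a, b`
  have hthird : ∀ a b c d, a < b → Perp a c → Perp b c → Perp a d → Perp b d →
      cocycle (f a) (f b) (f c) = cocycle (f a) (f b) (f d) := by
    have aux : ∀ a b c d, Perp a c → Perp b c → Perp a d → Perp b d → Perp c d →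
        cocycle (f a) (f b) (f c) = cocycle (f a) (f b) (f d) := by
      intro a b c d hac hbc had hbd hcd
      have h1 := hzero b c d (by simp [cocycle, hbc.sgn_eq, hcd.sgn_eq, hbd.symm.sgn_eq])
      have h2 := hzero a c d (by simp [cocycle, hac.sgn_eq, hcd.sgn_eq, had.symm.sgn_eq])
      linear_combination h1 - h2 - hco a b c d
    intro a b c d _ hac hbc had hbd
    obtain ⟨e, he⟩ := exists_perp hU hH {a, b, c, d}
    rw [aux a b c e hac hbc (he _ (by simp)) (he _ (by simp)) (he _ (by simp)),
      aux a b d e had hbd (he _ (by simp)) (he _ (by simp)) (he _ (by simp))]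
  -- changing the upper or the lower point
  have hright : ∀ a b b' c, a < b → a < b' → Perp b b' → Perp a c → Perp b c → Perp b' c →
      cocycle (f a) (f b) (f c) = cocycle (f a) (f b') (f c) := by
    intro a b b' c hab hab' hbb hac hbc hbc'
    have h1 := hzero a b b' (by
      simp [cocycle, hbb.sgn_eq, sgn_eq_one.2 hab, sgn_eq_neg_one.2 hab'])
    have h2 := hzero b b' c (by simp [cocycle, hbb.sgn_eq, hbc'.sgn_eq, hbc.symm.sgn_eq])
    linear_combination hco a b b' c + h1 - h2
  have hleft : ∀ a a' b c, a < b → a' < b → Perp a a' → Perp a c → Perp a' c → Perp b c →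
      cocycle (f a) (f b) (f c) = cocycle (f a') (f b) (f c) := by
    intro a a' b c hab hab' haa hac hac' hbc
    have h1 := hzero a a' b (by
      simp [cocycle, haa.sgn_eq, sgn_eq_one.2 hab', sgn_eq_neg_one.2 hab])
    have h2 := hzero a a' c (by simp [cocycle, haa.sgn_eq, hac'.sgn_eq, hac.symm.sgn_eq])
    linear_combination -hco a a' b c - h1 + h2
  have hconst : ∀ a b c a' b' c', a < b → Perp a c → Perp b c → a' < b' → Perp a' c' →
      Perp b' c' → cocycle (f a) (f b) (f c) = cocycle (f a') (f b') (f c') := by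
    intro a b c a' b' c' hab hac hbc hab' hac' hbc'
    obtain ⟨u, hu⟩ := exists_perp hU hH {a, b, a', b'}
    obtain ⟨v, hv⟩ := exists_extension hU hH {a, b, u} {a, u}
    have hav : a < v := (hv a (by simp)).1 ⟨a, by simp, le_rfl⟩
    have huv : u < v := (hv u (by simp)).1 ⟨u, by simp, le_rfl⟩
    have hbv : Perp b v := (hv b (by simp)).2 (by
      simp [hab.not_ge, (hu b (by simp)).1])
    obtain ⟨w, hw⟩ := exists_extension hU hH {a', b', u, v} {a', u}
    have haw : a' < w := (hw a' (by simp)).1 ⟨a', by simp, le_rfl⟩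
    have huw : u < w := (hw u (by simp)).1 ⟨u, by simp, le_rfl⟩
    have hbw : Perp b' w := (hw b' (by simp)).2 (by
      simp [hab'.not_ge, (hu b' (by simp)).1])
    have hvw : Perp v w := (hw v (by simp)).2 (by
      simp only [Set.mem_insert_iff, Set.mem_singleton_iff, forall_eq_or_imp, forall_eq]
      exact ⟨fun h => (hu a' (by simp)).2 (huv.le.trans h), huv.not_ge⟩)
    obtain ⟨d, hd⟩ := exists_perp hU hH {a, b, a', b', u, v, w}
    simp only [Finset.mem_insert, Finset.mem_singleton, forall_eq_or_imp, forall_eq] at hd hu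
    obtain ⟨da, db, da', db', du, dv, dw⟩ := hd
    obtain ⟨ua, ub, ua', ub'⟩ := hu
    calc _ = cocycle (f a) (f b) (f d) := hthird _ _ _ _ hab hac hbc da db
      _ = cocycle (f a) (f v) (f d) := hright _ _ _ _ hab hav hbv da db dv
      _ = cocycle (f u) (f v) (f d) := hleft _ _ _ _ hav huv ua da du dv
      _ = cocycle (f u) (f w) (f d) := hright _ _ _ _ huv huw hvw du dv dw
      _ = cocycle (f a') (f w) (f d) := (hleft _ _ _ _ haw huw ua' da' du dw).symm
      _ = cocycle (f a') (f b') (f d) := (hright _ _ _ _ hab' haw hbw da' db' dw).symm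
      _ = _ := (hthird _ _ _ _ hab' hac' hbc' da' db').symm
  have hk : ∃ k : ZMod 3, ∀ a b c, a < b → Perp a c → Perp b c →
      cocycle (f a) (f b) (f c) = k := by
    by_cases hex : ∃ a b c : P, a < b ∧ Perp a c ∧ Perp b c
    · obtain ⟨a, b, c, hab, hac, hbc⟩ := hex
      exact ⟨cocycle (f a) (f b) (f c), fun a' b' c' hab' hac' hbc' =>
        hconst _ _ _ _ _ _ hab' hac' hbc' hab hac hbc⟩
    · exact ⟨0, fun a b c hab hac hbc => absurd ⟨a, b, c, hab, hac, hbc⟩ hex⟩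
  obtain ⟨k, hk⟩ := hk
  have hchain : ∀ a b c, a < b → b < c → cocycle (f a) (f b) (f c) = k := by
    intro a b c hab hbc
    obtain ⟨d, hd⟩ := exists_extension hU hH {a, b, c} {a}
    have had : a < d := (hd a (by simp)).1 ⟨a, by simp, le_rfl⟩
    have hbd : Perp b d := (hd b (by simp)).2 (by simp [hab.not_ge])
    have hcd : Perp c d := (hd c (by simp)).2 (by simp [(hab.trans hbc).not_ge])
    have h1 := hzero a b d (by
      simp [cocycle, hbd.sgn_eq, sgn_eq_one.2 hab, sgn_eq_neg_one.2 had])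
    have h2 := hzero a c d (by
      simp [cocycle, hcd.sgn_eq, sgn_eq_one.2 (hab.trans hbc), sgn_eq_neg_one.2 had])
    linear_combination hk b c d hbc hbd hcd + h1 - h2 - hco a b c d
  have hcyc : ∀ a b c, cocycle a b c = 1 → cocycle (f a) (f b) (f c) = k := by
    intro a b c h
    rw [← cyc_iff] at h
    rcases h with h | h | h | h | h | h
    · exact hchain _ _ _ h.1 h.2
    · rw [← cocycle_rotate]; exact hchain _ _ _ h.1 h.2
    · rw [cocycle_rotate (f c)]; exact hchain _ _ _ h.1 h.2
    · exact hk _ _ _ h.1 h.2.1.symm h.2.2.symm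
    · rw [← cocycle_rotate]; exact hk _ _ _ h.1 h.2.1.symm h.2.2.symm
    · rw [cocycle_rotate (f c)]; exact hk _ _ _ h.1 h.2.2.symm h.2.1.symm
  refine ⟨k, fun a b c => ?_⟩
  have hcases : ∀ x : ZMod 3, x = 0 ∨ x = 1 ∨ x = -1 := by decide
  rcases hcases (cocycle a b c) with h | h | h
  · rw [hzero _ _ _ h, h, mul_zero]
  · rw [hcyc _ _ _ h, h, mul_one]
  · have := hcyc c b a (by rw [cocycle_swap, h, neg_neg])
    rw [cocycle_swap] at this
    rw [h]
    linear_combination -this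

/-- A permutation preserving `Pari` which is not a rotation switches `Cyc` and
`Cyc'`. -/
theorem pari_preserving_not_rotation_switches [Countable P] [Infinite P]
    (hU : IsUniversal P) (hH : IsHomogeneous P) (f : Equiv.Perm P)
    (hpar : Preserves3 (⇑f) Pari) (hrot : ¬ IsRotation f) :
    ∀ a b c : P, Cyc a b c ↔ Cyc' (f a) (f b) (f c) := by
  have hcases : ∀ x : ZMod 3, x = 0 ∨ x = 1 ∨ x = -1 := by decide
  obtain ⟨k, hk⟩ := exists_cocycle_map_eq_mul hU hH hpar
  intro a b c
  rw [Cyc', cyc_iff, cyc_iff, cocycle_swap (f a)]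
  rcases hcases k with rfl | rfl | rfl
  · have h : cocycle a b c = 0 := by
      rw [cocycle_map_eq_zero_iff hpar, hk, zero_mul]
    rw [hk, h, mul_zero, neg_zero]
  · exact absurd (isRotation_of_cocycle_eq hU hH fun a b c => by rw [hk, one_mul]) hrot
  · rw [hk, neg_mul, one_mul, neg_neg]
end
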